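/- If the rotation set of f ∈ Homeo₀(T²) is δ-upper-stable in Homeo₀(T²) for some δ > 0, then for any lift f̃ of f the rotation set equals the (δ/2)-pseudo-rotation set: ρ(f̃) = ρ_{δ/2}(f̃). -/

import Mathlib

noncomputable section

open Metric Set Filter Topology MeasureTheory Pointwise

/-- The plane `ℝ²` with the Euclidean metric. -/
abbrev R2 : Type := EuclideanSpace ℝ (Fin 2)

/-- The integer lattice `ℤ² ⊂ ℝ²`. -/
def intLattice : AddSubgroup R2 where
  carrier := {v : R2 | ∀ i, ∃ n : ℤ, v i = (n : ℝ)}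
  add_mem' := by
    intro a b ha hb i
    obtain ⟨m, hm⟩ := ha i
    obtain ⟨n, hn⟩ := hb i
    exact ⟨m + n, by push_cast; rw [← hm, ← hn]; rfl⟩
  zero_mem' := fun i => ⟨0, by simp⟩
  neg_mem' := by
    intro a ha i
    obtain ⟨m, hm⟩ := ha i
    exact ⟨-m, by push_cast; rw [← hm]; rfl⟩

/-- The torus `T² = ℝ²/ℤ²`, with the quotient (Euclidean) metric. -/
abbrev T2 : Type := R2 ⧸ intLattice

/-- The covering projection `π : ℝ² → T²`. -/
def pr : R2 → T2 := QuotientAddGroup.mk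

instance : MeasurableSpace T2 := borel T2
instance : BorelSpace T2 := ⟨rfl⟩

/-- A fundamental domain `[0,1)²` for the lattice action. -/
def fundDomain : Set R2 := {x : R2 | ∀ i, x i ∈ Set.Ico (0 : ℝ) 1}

/-- Lebesgue (Haar) probability measure on the torus `T²`. -/
def lebT2 : Measure T2 := Measure.map pr (volume.restrict fundDomain)

/-- `F : ℝ² → ℝ²` is a lift of `f : T² → T²` if `π ∘ F = f ∘ π` and
`F (x + w) = F x + w` for every lattice vector `w ∈ ℤ²`. -/
structure IsLift (f : T2 ≃ₜ T2) (F : R2 ≃ₜ R2) : Prop where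
  proj : ∀ x : R2, pr (F x) = f (pr x)
  equivariant : ∀ x : R2, ∀ w ∈ intLattice, F (x + w) = F x + w

/-- `Homeo₀(T²)`: homeomorphisms of the torus isotopic to the identity,
characterized as those admitting a lift commuting with integer translations. -/
def Homeo0 : Set (T2 ≃ₜ T2) := {f | ∃ F : R2 ≃ₜ R2, IsLift f F}

/-- `Homeo_{0,λ}(T²)`: elements of `Homeo₀(T²)` preserving Lebesgue measure. -/
def Homeo0Leb : Set (T2 ≃ₜ T2) :=
  {f | f ∈ Homeo0 ∧ MeasurePreserving f lebT2 lebT2}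

/-- The uniform `C⁰` distance `d_{C⁰}(f,g) = sup_x d(f(x), g(x))` on torus maps. -/
def dC0 (f g : T2 ≃ₜ T2) : ℝ := ⨆ x : T2, dist (f x) (g x)

/-- The uniform distance `sup_{x ∈ ℝ²} ‖F(x) − G(x)‖` between maps of the plane. -/
def supDist (F G : R2 → R2) : ℝ := ⨆ x : R2, dist (F x) (G x)

/-- The rotation set `ρ(F̃)` of a lift: all limits `(F̃^{n_k}(z_k) − z_k)/n_k`. -/
def rotSet (F : R2 ≃ₜ R2) : Set R2 :=
  {v | ∃ (z : ℕ → R2) (n : ℕ → ℕ), Tendsto n atTop atTop ∧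
    Tendsto (fun k => (n k : ℝ)⁻¹ • ((⇑F)^[n k] (z k) - z k)) atTop (𝓝 v)}

/-- The rotation set of `f`, with fixed lift `F`, is `δ`-upper-stable in `H`. -/
def UpperStable (H : Set (T2 ≃ₜ T2)) (F : R2 ≃ₜ R2) (δ : ℝ) : Prop :=
  ∀ g ∈ H, ∀ G : R2 ≃ₜ R2, IsLift g G → supDist (⇑F) (⇑G) < δ →
    rotSet G ⊆ rotSet F

/-- The rotation set of `f`, with fixed lift `F`, is `δ`-stable in `H`. -/
def StableRS (H : Set (T2 ≃ₜ T2)) (F : R2 ≃ₜ R2) (δ : ℝ) : Prop :=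
  ∀ g ∈ H, ∀ G : R2 ≃ₜ R2, IsLift g G → supDist (⇑F) (⇑G) < δ →
    rotSet G = rotSet F

/-- `f` has a stable rotation set in `H`. -/
def HasStableRotSet (H : Set (T2 ≃ₜ T2)) (f : T2 ≃ₜ T2) : Prop :=
  ∃ F : R2 ≃ₜ R2, IsLift f F ∧ ∃ δ > 0, StableRS H F δ

/-- `S` is open in `H` for the uniform `C⁰` topology. -/
def OpenIn (H S : Set (T2 ≃ₜ T2)) : Prop :=
  ∀ f ∈ S ∩ H, ∃ δ > 0, ∀ g ∈ H, dC0 f g < δ → g ∈ S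

/-- `S` is dense in `H` for the uniform `C⁰` topology. -/
def DenseIn (H S : Set (T2 ≃ₜ T2)) : Prop :=
  ∀ f ∈ H, ∀ ε > 0, ∃ g ∈ S ∩ H, dC0 f g < ε

/-- `(x_i)_{0 ≤ i ≤ n}` is a finite `ε`-pseudo-orbit of `F`. -/
def IsPseudoOrbitUpTo (F : R2 → R2) (ε : ℝ) (x : ℕ → R2) (n : ℕ) : Prop :=
  ∀ i < n, dist (F (x i)) (x (i + 1)) < ε

/-- `(x_i)_{i ∈ ℕ}` is an infinite `ε`-pseudo-orbit of `F`. -/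
def IsPseudoOrbit (F : R2 → R2) (ε : ℝ) (x : ℕ → R2) : Prop :=
  ∀ i : ℕ, dist (F (x i)) (x (i + 1)) < ε

/-- The `ε`-pseudo-rotation set `ρ_ε(F̃)`. -/
def pseudoRotSet (F : R2 → R2) (ε : ℝ) : Set R2 :=
  {v | ∃ (n : ℕ → ℕ) (x : ℕ → ℕ → R2), Tendsto n atTop atTop ∧
    (∀ k, IsPseudoOrbitUpTo F ε (x k) (n k)) ∧
    Tendsto (fun k => (n k : ℝ)⁻¹ • (x k (n k) - x k 0)) atTop (𝓝 v)}

/-- The oscillation `osc(f) = sup_{x,y} ‖(F(x) − x) − (F(y) − y)‖` of a lift. -/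
def osc (F : R2 → R2) : ℝ := ⨆ p : R2 × R2, ‖(F p.1 - p.1) - (F p.2 - p.2)‖

/-- `f` has the shadowing property. -/
def Shadowing (f : T2 ≃ₜ T2) : Prop :=
  ∀ ε > 0, ∃ δ > 0, ∀ x : ℕ → T2, (∀ i, dist (f (x i)) (x (i + 1)) < δ) →
    ∃ z : T2, ∀ i, dist ((⇑f)^[i] z) (x i) < ε

/-- `v ∈ ℚ² ⊂ ℝ²`. -/
def IsRationalPoint (v : R2) : Prop := ∀ i, ∃ q : ℚ, v i = (q : ℝ)


section Part1
lemma exists_clog {E : Type*} [NormedAddCommGroup E] [NormedSpace ℝ E] {K : Set E}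
    (hK : IsCompact K) (hc : Convex ℝ K) (f : E → ℂ) (hf : ContinuousOn f K)
    (h0 : ∀ x ∈ K, f x ≠ 0) :
    ∃ l : E → ℂ, ContinuousOn l K ∧ ∀ x ∈ K, Complex.exp (l x) = f x := by
  rcases K.eq_empty_or_nonempty with rfl | ⟨x0, hx0⟩
  · exact ⟨fun _ => 0, by simp, by simp⟩
  -- lower bound
  obtain ⟨xm, hxm, hmin⟩ := hK.exists_isMinOn ⟨x0, hx0⟩ hf.norm
  have hmpos : 0 < ‖f xm‖ := norm_pos_iff.2 (h0 _ hxm)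
  have huc := hK.uniformContinuousOn_of_continuous hf
  obtain ⟨d, hd, hd'⟩ := Metric.uniformContinuousOn_iff.1 huc _ hmpos
  obtain ⟨R, hR⟩ := hK.isBounded.subset_closedBall x0
  obtain ⟨N, hN⟩ := exists_nat_gt ((|R| + 1) / d)
  have hN0 : (0 : ℝ) < N := lt_trans (by positivity) hN
  set P : ℕ → E → E := fun k x => x0 + ((k : ℝ) / N) • (x - x0) with hP
  have hPmem : ∀ k ≤ N, ∀ x ∈ K, P k x ∈ K := by
    intro k hk x hx
    have h1 : (k : ℝ) / N ≤ 1 := by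
      rw [div_le_one hN0]; exact_mod_cast hk
    exact hc.add_smul_sub_mem hx0 hx ⟨by positivity, h1⟩
  have hPc : ∀ k, Continuous (P k) := by
    intro k; simp only [hP]; fun_prop
  have hPd : ∀ k, ∀ x ∈ K, dist (P (k + 1) x) (P k x) < d := by
    intro k x hx
    have : P (k + 1) x - P k x = (1 / N : ℝ) • (x - x0) := by
      simp only [hP]; push_cast
      rw [add_sub_add_left_eq_sub, ← sub_smul]; congr 1; field_simp; ring
    rw [dist_eq_norm, this, norm_smul]
    have hx' : ‖x - x0‖ ≤ R := by simpa [dist_eq_norm] using hR hx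
    have h3 : (|R| + 1) < N * d := by rwa [div_lt_iff₀ hd] at hN
    rw [Real.norm_of_nonneg (by positivity), div_mul_eq_mul_div, one_mul, div_lt_iff₀ hN0]
    linarith [le_abs_self R, mul_comm (N:ℝ) d]
  have hratio : ∀ k < N, ∀ x ∈ K, f (P (k + 1) x) / f (P k x) ∈ Complex.slitPlane := by
    intro k hk x hx
    have h1 := hPmem k hk.le x hx
    have h2 := hPmem (k + 1) hk x hx
    have h3 := hd' _ h2 _ h1 (hPd k x hx)
    have h4 : ‖f xm‖ ≤ ‖f (P k x)‖ := hmin h1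
    have hne := h0 _ h1
    have h5 : ‖f (P (k + 1) x) / f (P k x) - 1‖ < 1 := by
      rw [div_sub_one hne, norm_div, div_lt_one (norm_pos_iff.2 hne)]
      rw [dist_eq_norm] at h3; linarith
    left
    have := (Complex.abs_re_le_norm (f (P (k + 1) x) / f (P k x) - 1)).trans_lt h5
    rw [abs_lt] at this
    simp only [Complex.sub_re, Complex.one_re] at this
    linarith [this.1]
  have key : ∀ n ≤ N, ∀ x ∈ K, Complex.exp (Complex.log (f x0) +
      ∑ k ∈ Finset.range n, Complex.log (f (P (k + 1) x) / f (P k x))) = f (P n x) := by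
    intro n
    induction n with
    | zero => intro _ x hx; simp [hP, Complex.exp_log (h0 _ hx0)]
    | succ n ih =>
      intro hn x hx
      have hne := h0 _ (hPmem n (by omega) x hx)
      rw [Finset.sum_range_succ, ← add_assoc, Complex.exp_add, ih (by omega) x hx,
        Complex.exp_log (Complex.slitPlane_ne_zero (hratio n (by omega) x hx))]
      field_simp
  refine ⟨fun x => Complex.log (f x0) +
      ∑ k ∈ Finset.range N, Complex.log (f (P (k + 1) x) / f (P k x)), ?_, ?_⟩
  · refine continuousOn_const.add (continuousOn_finsetSum _ fun k hk => ?_)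
    have hk' := Finset.mem_range.1 hk
    refine ContinuousOn.clog (ContinuousOn.div ?_ ?_ ?_) (hratio k hk')
    · exact hf.comp (hPc _).continuousOn (fun x hx => hPmem _ hk' x hx)
    · exact hf.comp (hPc _).continuousOn (fun x hx => hPmem _ hk'.le x hx)
    · exact fun x hx => h0 _ (hPmem _ hk'.le x hx)
  · intro x hx
    rw [key N le_rfl x hx]
    congr 1
    simp only [hP]; rw [div_self hN0.ne']; simp

lemma cos_pos_interval {X : Type*} [TopologicalSpace X] {K : Set X} (hK : IsPreconnected K)
    (u : X → ℝ) (hu : ContinuousOn u K) (hc : ∀ x ∈ K, 0 < Real.cos (u x)) :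
    ∃ n : ℤ, ∀ x ∈ K, |u x - 2 * Real.pi * n| < Real.pi / 2 := by
  rcases K.eq_empty_or_nonempty with rfl | ⟨x0, hx0⟩
  · exact ⟨0, by simp⟩
  have hpi := Real.pi_pos
  have hoc := (hK.image u hu).ordConnected
  set n := round (u x0 / (2 * Real.pi)) with hn
  have hno : ∀ s : ℝ, Real.cos s = 0 → s ∉ u '' K := by
    rintro s hs ⟨y, hy, rfl⟩
    exact (hc y hy).ne' hs
  have c1 : Real.cos (2 * Real.pi * n + Real.pi / 2) = 0 := by
    rw [show 2 * Real.pi * n + Real.pi / 2 = Real.pi / 2 + n * (2 * Real.pi) by ring,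
      Real.cos_add_int_mul_two_pi, Real.cos_pi_div_two]
  have c2 : Real.cos (2 * Real.pi * n - Real.pi / 2) = 0 := by
    rw [show 2 * Real.pi * n - Real.pi / 2 = -(Real.pi / 2) + n * (2 * Real.pi) by ring,
      Real.cos_add_int_mul_two_pi, Real.cos_neg, Real.cos_pi_div_two]
  have h1 : |u x0 - 2 * Real.pi * n| < Real.pi / 2 := by
    have h2 : |u x0 - 2 * Real.pi * n| ≤ Real.pi := by
      have := abs_sub_round (u x0 / (2 * Real.pi))
      rw [← hn] at this
      have h3 : u x0 - 2 * Real.pi * n = (2 * Real.pi) * (u x0 / (2 * Real.pi) - n) := by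
        field_simp
      rw [h3, abs_mul, abs_of_pos (by positivity : 0 < 2 * Real.pi)]
      nlinarith
    by_contra h4
    push Not at h4
    have h5 := hc x0 hx0
    have h6 : Real.cos (|u x0 - 2 * Real.pi * n|) ≤ 0 :=
      Real.cos_nonpos_of_pi_div_two_le_of_le h4 (by linarith)
    rw [Real.cos_abs, show u x0 - 2 * Real.pi * n = u x0 - n * (2 * Real.pi) by ring,
      Real.cos_sub_int_mul_two_pi] at h6
    linarith
  refine ⟨n, fun x hx => ?_⟩
  have hx' : u x ∈ u '' K := ⟨x, hx, rfl⟩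
  have hx0' : u x0 ∈ u '' K := ⟨x0, hx0, rfl⟩
  rw [abs_lt] at h1 ⊢
  constructor
  · by_contra h
    exact hno _ c2 (hoc.out hx' hx0' ⟨by linarith, by linarith⟩)
  · by_contra h
    exact hno _ c1 (hoc.out hx0' hx' ⟨by linarith, by linarith⟩)

end Part1

section Part2
/-- closed unit square -/
def DD : Set R2 := {x : R2 | ∀ i, x i ∈ Set.Icc (0 : ℝ) 1}

/-- identification with the complex plane -/
def cI : R2 ≃ₗᵢ[ℝ] ℂ := Complex.orthonormalBasisOneI.repr.symm

lemma DD_convex : Convex ℝ DD := by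
  intro x hx y hy a b ha hb hab i
  have := convex_Icc (0:ℝ) 1 (hx i) (hy i) ha hb hab
  simpa using this

lemma DD_closed : IsClosed DD := by
  have : DD = ⋂ i, (fun x : R2 => x i) ⁻¹' Set.Icc (0:ℝ) 1 := by
    ext x; simp [DD]
  rw [this]
  exact isClosed_iInter fun i => isClosed_Icc.preimage (by fun_prop)

lemma DD_dist {x y : R2} (hx : x ∈ DD) (hy : y ∈ DD) : ‖x - y‖ ≤ 3 / 2 := by
  rw [EuclideanSpace.norm_eq]
  refine Real.sqrt_le_iff.2 ⟨by norm_num, ?_⟩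
  simp only [Fin.sum_univ_two, PiLp.sub_apply, Real.norm_eq_abs, sq_abs]
  have h0 := hx 0; have h1 := hx 1; have h2 := hy 0; have h3 := hy 1
  simp only [Set.mem_Icc] at h0 h1 h2 h3
  nlinarith [h0.1, h0.2, h1.1, h1.2, h2.1, h2.2, h3.1, h3.2]

lemma DD_zero : (0 : R2) ∈ DD := by intro i; simp

lemma DD_norm {x : R2} (hx : x ∈ DD) : ‖x‖ ≤ 3 / 2 := by
  simpa using DD_dist hx DD_zero

lemma DD_compact : IsCompact DD :=
  Metric.isCompact_of_isClosed_isBounded DD_closed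
    ((Metric.isBounded_closedBall (x := (0:R2)) (r := 3/2)).subset fun x hx => by
      simpa using DD_norm hx)

lemma exists_lattice (y : R2) : ∃ w ∈ intLattice, y - w ∈ DD := by
  refine ⟨WithLp.toLp 2 fun i => (⌊y i⌋ : ℝ), fun i => ⟨⌊y i⌋, rfl⟩, fun i => ?_⟩
  simp only [PiLp.sub_apply]
  exact ⟨by linarith [Int.floor_le (y i)], by linarith [(Int.lt_floor_add_one (y i)).le]⟩

lemma mz_key (g : R2 → ℂ) (hg : Continuous g) (hinj : Function.Injective g)
    (heq : ∀ x, ∀ w ∈ intLattice, g (x + w) = g x + cI w)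
    (h0 : (0 : ℂ) ∈ convexHull ℝ (g '' DD)) : ∃ x ∈ DD, ‖g x‖ ≤ 20 := by
  by_contra hcon
  push Not at hcon
  have hpi := Real.pi_pos
  have hgne : ∀ x ∈ DD, g x ≠ 0 := fun x hx h => by
    have := hcon x hx; rw [h, norm_zero] at this; linarith
  obtain ⟨l, hl, hle⟩ := exists_clog DD_compact DD_convex g hg.continuousOn hgne
  -- rotated real part
  set r : ℝ → ℂ → ℝ := fun τ z => (z * Complex.exp (-(τ * Complex.I))).re with hr
  have rpolar : ∀ τ (a : ℂ), r τ (Complex.exp a) = Real.exp a.re * Real.cos (a.im - τ) := by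
    intro τ a
    simp only [hr]
    rw [← Complex.exp_add, Complex.exp_re]
    simp [sub_eq_add_neg]
  have rcont : Continuous fun q : ℝ × ℂ => r q.1 q.2 := by
    simp only [hr]; fun_prop
  have radd : ∀ τ a b, r τ (a + b) = r τ a + r τ b := by
    intro τ a b; simp only [hr, add_mul, Complex.add_re]
  have rsub : ∀ τ a b, r τ (a - b) = r τ a - r τ b := by
    intro τ a b; simp only [hr, sub_mul, Complex.sub_re]
  have rle : ∀ τ a, |r τ a| ≤ ‖a‖ := by
    intro τ a
    simp only [hr]
    refine (Complex.abs_re_le_norm _).trans ?_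
    rw [norm_mul, show -((τ:ℂ) * Complex.I) = ((-τ : ℝ) : ℂ) * Complex.I by push_cast; ring,
      Complex.norm_exp_ofReal_mul_I, mul_one]
  have rper : ∀ τ (k : ℤ) a, r (τ + 2 * Real.pi * k) a = r τ a := by
    intro τ k a
    simp only [hr]
    congr 2
    rw [show -(((τ + 2 * Real.pi * k : ℝ) : ℂ) * Complex.I)
      = -((τ : ℂ) * Complex.I) + ((-k : ℤ) : ℂ) * (2 * Real.pi * Complex.I) by push_cast; ring,
      Complex.exp_add, Complex.exp_int_mul_two_pi_mul_I, mul_one]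
  -- maximizers
  set Mx : ℝ → R2 → Prop := fun τ x => ∀ y ∈ DD, r τ (g y) ≤ r τ (g x) with hMx
  have hmax : ∀ τ, ∃ x ∈ DD, Mx τ x := by
    intro τ
    obtain ⟨x, hx, h⟩ := DD_compact.exists_isMaxOn ⟨0, DD_zero⟩
      (f := fun x => r τ (g x)) (rcont.comp (by fun_prop : Continuous fun x => (τ, g x))).continuousOn
    exact ⟨x, hx, fun y hy => h hy⟩
  have hmaxpos : ∀ τ, ∀ x ∈ DD, Mx τ x → 0 ≤ r τ (g x) := by
    intro τ x hx hm
    by_contra hneg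
    push Not at hneg
    have hsub : convexHull ℝ (g '' DD) ⊆ {z | r τ z < 0} := by
      refine convexHull_min ?_ ?_
      · rintro _ ⟨y, hy, rfl⟩
        exact (hm y hy).trans_lt hneg
      · refine convex_halfSpace_lt (𝕜 := ℝ) (f := fun z => r τ z) ⟨radd τ, ?_⟩ 0
        intro c z
        simp [hr, mul_assoc]; ring
    have := hsub h0
    simp [hr] at this
  have hcosnn : ∀ τ, ∀ x ∈ DD, Mx τ x → 0 ≤ Real.cos ((l x).im - τ) := by
    intro τ x hx hm
    have := hmaxpos τ x hx hm
    rw [← hle x hx, rpolar] at this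
    exact nonneg_of_mul_nonneg_right this (Real.exp_pos _)
  set Θ : R2 → ℝ := fun x => (l x).im with hΘ
  have hΘc : ContinuousOn Θ DD := Complex.continuous_im.comp_continuousOn hl
  -- the two closed sets
  have hproj : ∀ S : Set ℝ, IsClosed S →
      IsClosed {τ : ℝ | ∃ x ∈ DD, Mx τ x ∧ Θ x - τ ∈ S} := by
    intro S hS
    rw [← isSeqClosed_iff_isClosed]
    intro τs τ hτs hlim
    choose xs hxs hxm hxS using hτs
    obtain ⟨x, hx, φ, hφ, hxl⟩ := DD_compact.tendsto_subseq hxs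
    have hτ' := hlim.comp hφ.tendsto_atTop
    refine ⟨x, hx, ?_, ?_⟩
    · intro y hy
      have t1 : Tendsto (fun k => r (τs (φ k)) (g y)) atTop (𝓝 (r τ (g y))) :=
        (rcont.tendsto (τ, g y)).comp (hτ'.prodMk_nhds tendsto_const_nhds)
      have t2 : Tendsto (fun k => r (τs (φ k)) (g (xs (φ k)))) atTop (𝓝 (r τ (g x))) :=
        (rcont.tendsto (τ, g x)).comp (hτ'.prodMk_nhds ((hg.tendsto x).comp hxl))
      exact le_of_tendsto_of_tendsto' t1 t2 fun k => hxm _ y hy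
    · have t3 : Tendsto (fun k => Θ (xs (φ k))) atTop (𝓝 (Θ x)) :=
        (hΘc x hx).tendsto.comp (tendsto_nhdsWithin_iff.2
          ⟨hxl, Eventually.of_forall fun k => hxs _⟩)
      exact hS.mem_of_tendsto (t3.sub hτ') (Eventually.of_forall fun k => hxS _)
  have hclS1 : IsClosed {s : ℝ | |s| ≤ Real.pi / 2} := isClosed_le continuous_abs continuous_const
  have hclS2 : IsClosed {s : ℝ | 3 * Real.pi / 2 ≤ |s|} := isClosed_le continuous_const continuous_abs
  have hcl1 := hproj _ hclS1
  have hcl2 := hproj _ hclS2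
  obtain ⟨B, hB⟩ : ∃ B, ∀ x ∈ DD, |Θ x| ≤ B := by
    obtain ⟨B, hB⟩ := DD_compact.exists_bound_of_continuousOn hΘc
    exact ⟨B, hB⟩
  have hdich : ∀ s : ℝ, 0 ≤ Real.cos s → |s| ≤ Real.pi / 2 ∨ 3 * Real.pi / 2 ≤ |s| := by
    intro s hs
    by_contra hh
    push Not at hh
    rw [← Real.cos_abs] at hs
    have := Real.cos_neg_of_pi_div_two_lt_of_lt hh.1 (by linarith)
    linarith
  have hinter := (isPreconnected_closed_iff.1 (isPreconnected_univ (α := ℝ))) _ _ hcl1 hcl2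
    (by
      intro τ _
      obtain ⟨x, hx, hm⟩ := hmax τ
      rcases hdich _ (hcosnn τ x hx hm) with h | h
      · exact Or.inl ⟨x, hx, hm, h⟩
      · exact Or.inr ⟨x, hx, hm, h⟩)
    (by
      obtain ⟨x, hx, hm⟩ := hmax 0
      refine ⟨2 * Real.pi * round (Θ x / (2 * Real.pi)), trivial, x, hx, ?_, ?_⟩
      · intro y hy
        have e1 := rper 0 (round (Θ x / (2 * Real.pi)))
        rw [zero_add] at e1
        rw [e1, e1]; exact hm y hy
      · set k := round (Θ x / (2 * Real.pi)) with hk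
        have e2 : |Θ x - 2 * Real.pi * k| ≤ Real.pi := by
          have := abs_sub_round (Θ x / (2 * Real.pi))
          rw [← hk] at this
          rw [show Θ x - 2 * Real.pi * k = (2 * Real.pi) * (Θ x / (2 * Real.pi) - k) by
            field_simp, abs_mul, abs_of_pos (by positivity : 0 < 2 * Real.pi)]
          nlinarith
        have e3 := hcosnn 0 x hx hm
        have e4 : 0 ≤ Real.cos (Θ x - 2 * Real.pi * k) := by
          rw [show Θ x - 2 * Real.pi * k = Θ x - k * (2 * Real.pi) by ring,
            Real.cos_sub_int_mul_two_pi]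
          simpa using e3
        rcases hdich _ e4 with h | h
        · exact h
        · exfalso; linarith)
    (by
      obtain ⟨x, hx, hm⟩ := hmax (B + 3 * Real.pi / 2)
      refine ⟨B + 3 * Real.pi / 2, trivial, x, hx, hm, ?_⟩
      have := (abs_le.1 (hB x hx)).2
      show 3 * Real.pi / 2 ≤ |_|
      rw [abs_of_nonpos (by linarith)]
      linarith)
  obtain ⟨τ, -, ⟨x1, hx1, hm1, ht1⟩, ⟨x2, hx2, hm2, ht2⟩⟩ := hinter
  simp only [Set.mem_ofPred_eq] at ht1 ht2
  set h := r τ (g x1) with hh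
  have hh0 : 0 ≤ h := hmaxpos τ x1 hx1 hm1
  have hh2 : r τ (g x2) = h := le_antisymm (hm1 x2 hx2) (hm2 x1 hx1)
  set e : ℂ := Complex.exp (τ * Complex.I) with he
  have re : r τ e = 1 := by rw [he, rpolar]; simp
  have rsmul : ∀ (c : ℝ) (z : ℂ), r τ ((c : ℂ) * z) = c * r τ z := by
    intro c z; simp [hr, mul_assoc]; ring
  have ne : ‖e‖ = 1 := Complex.norm_exp_ofReal_mul_I τ
  -- the lattice vector
  obtain ⟨w, hw, hwD⟩ := exists_lattice (cI.symm (-((5:ℝ):ℂ) * e - g x1))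
  have hcw : ‖g x1 + cI w + ((5:ℝ):ℂ) * e‖ ≤ 3 / 2 := by
    have := DD_norm hwD
    rw [← cI.norm_map, map_sub, cI.apply_symm_apply] at this
    have e3 : -(g x1 + cI w + ((5:ℝ):ℂ) * e) = -((5:ℝ):ℂ) * e - g x1 - cI w := by ring
    rw [← norm_neg, e3]; exact this
  set z0 := g x1 + cI w with hz0
  have hz0n : ‖z0‖ ≤ 7 := by
    have e1 : z0 = (z0 + ((5:ℝ):ℂ) * e) - ((5:ℝ):ℂ) * e := by ring
    rw [e1]
    refine (norm_sub_le _ _).trans ?_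
    have h5 : ‖((5:ℝ):ℂ)‖ = 5 := by simp
    rw [norm_mul, ne, h5]; linarith
  have hz0r : r τ z0 ≤ -3 := by
    have e1 := (abs_le.1 ((rle τ _).trans hcw)).2
    rw [radd, rsmul, re] at e1
    linarith
  have hwr : r τ (cI w) ≤ -3 := by
    have : r τ z0 = h + r τ (cI w) := by rw [hz0, radd]
    linarith
  set Y : ℝ → R2 := fun T => x1 + w - T • cI.symm e with hY
  have hYc : Continuous Y := by simp only [hY]; fun_prop
  have hYr : ∀ T, r τ (cI (Y T - x1)) = r τ (cI w) - T := by
    intro T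
    have : cI (Y T - x1) = cI w - (T : ℂ) * e := by
      simp only [hY]
      rw [show x1 + w - T • cI.symm e - x1 = w - T • cI.symm e by abel, map_sub, map_smul,
        cI.apply_symm_apply]; simp
    rw [this, rsub, rsmul, re, mul_one]
  have hgY : ∀ T, r τ (g (Y T)) ≤ h - 1 - T := by
    intro T
    obtain ⟨v, hv, hvD⟩ := exists_lattice (Y T)
    have e1 : g (Y T) = g (Y T - v) + cI v := by rw [← heq _ v hv, sub_add_cancel]
    have e2 : cI v = cI (Y T - x1) + cI (x1 - (Y T - v)) := by
      rw [← map_add]; congr 1; abel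
    have e3 := (abs_le.1 (rle τ (cI (x1 - (Y T - v))))).2
    rw [cI.norm_map] at e3
    have e4 := DD_dist hx1 hvD
    rw [e1, radd, e2, radd, hYr]
    have e5 := hm1 _ hvD
    linarith
  have hne : ∀ x ∈ DD, ∀ T, 0 ≤ T → g x - g (Y T) ≠ 0 := by
    intro x hx T hT h1
    have h2 := hinj (sub_eq_zero.1 h1)
    have e3 := (abs_le.1 (rle τ (cI (Y T - x1)))).1
    rw [cI.norm_map, hYr, ← h2] at e3
    have := DD_dist hx hx1
    linarith
  obtain ⟨R, hR⟩ := DD_compact.exists_bound_of_continuousOn hg.continuousOn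
  have hR0 : 0 ≤ R := (norm_nonneg _).trans (hR x1 hx1)
  set T1 : ℝ := R + h with hT1
  have hT10 : 0 ≤ T1 := by positivity
  obtain ⟨l2, hl2, hle2⟩ := exists_clog (K := DD ×ˢ Set.Icc (0:ℝ) T1)
    (DD_compact.prod isCompact_Icc) (DD_convex.prod (convex_Icc 0 T1))
    (fun q : R2 × ℝ => g q.1 - g (Y q.2)) (by fun_prop)
    (fun q hq => hne q.1 hq.1 q.2 hq.2.1)
  have hcospos : ∀ x ∈ DD, ∀ T ∈ Set.Icc (0:ℝ) T1, 0 < r τ (g x - g (Y T)) →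
      0 < Real.cos ((l2 (x, T)).im - τ) := by
    intro x hx T hT hp
    rw [← hle2 (x, T) ⟨hx, hT⟩, rpolar] at hp
    exact (pos_iff_pos_of_mul_pos hp).1 (Real.exp_pos _)
  have hx12 : ∀ x ∈ DD, r τ (g x) = h → ∃ n : ℤ, ∀ T ∈ Set.Icc (0:ℝ) T1,
      |((l2 (x, T)).im - τ) - 2 * Real.pi * n| < Real.pi / 2 := by
    intro x hx hxh
    refine cos_pos_interval isPreconnected_Icc (fun T => (l2 (x, T)).im - τ) ?_ ?_
    · refine ContinuousOn.sub (Complex.continuous_im.comp_continuousOn ?_) continuousOn_const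
      exact hl2.comp (by fun_prop : Continuous fun T : ℝ => (x, T)).continuousOn
        (fun T hT => ⟨hx, hT⟩)
    · intro T hT
      refine hcospos x hx T hT ?_
      rw [rsub, hxh]
      linarith [hgY T, hT.1]
  obtain ⟨n1, hn1⟩ := hx12 x1 hx1 rfl
  obtain ⟨n2, hn2⟩ := hx12 x2 hx2 hh2
  have hT1m : T1 ∈ Set.Icc (0:ℝ) T1 := ⟨hT10, le_rfl⟩
  have h0m : (0:ℝ) ∈ Set.Icc (0:ℝ) T1 := ⟨le_rfl, hT10⟩
  obtain ⟨n3, hn3⟩ : ∃ n : ℤ, ∀ x ∈ DD, |((l2 (x, T1)).im - τ) - 2 * Real.pi * n| < Real.pi / 2 := by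
    refine cos_pos_interval DD_convex.isPreconnected (fun x => (l2 (x, T1)).im - τ) ?_ ?_
    · refine ContinuousOn.sub (Complex.continuous_im.comp_continuousOn ?_) continuousOn_const
      exact hl2.comp (by fun_prop : Continuous fun x : R2 => (x, T1)).continuousOn
        (fun x hx => ⟨hx, hT1m⟩)
    · intro x hx
      refine hcospos x hx T1 hT1m ?_
      rw [rsub]
      have e1 := (abs_le.1 ((rle τ (g x)).trans (hR x hx))).1
      linarith [hgY T1]
  have intlem : ∀ (a : ℝ) (m n : ℤ), |a - 2 * Real.pi * m| < Real.pi / 2 →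
      |a - 2 * Real.pi * n| < 3 * Real.pi / 2 → m = n := by
    intro a m n h1 h2
    rw [abs_lt] at h1 h2
    have h3 : (m : ℝ) - n < 1 := by
      by_contra h4
      push Not at h4
      nlinarith
    have h4 : -1 < (m : ℝ) - n := by
      by_contra h4
      push Not at h4
      nlinarith
    have h5 : m - n < 1 := by exact_mod_cast h3
    have h6 : -1 < m - n := by exact_mod_cast h4
    omega
  have en1 : n1 = n3 := intlem _ _ _ (hn1 T1 hT1m) ((hn3 x1 hx1).trans (by linarith))
  have en2 : n2 = n3 := intlem _ _ _ (hn2 T1 hT1m) ((hn3 x2 hx2).trans (by linarith))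
  -- comparison at T = 0
  have hY0 : g (Y 0) = z0 := by
    simp only [hY]; rw [zero_smul, sub_zero, heq _ w hw]
  obtain ⟨m, hm⟩ : ∃ n : ℤ, ∀ x ∈ DD, |((l2 (x, 0)).im - Θ x) - 2 * Real.pi * n| < Real.pi / 2 := by
    refine cos_pos_interval DD_convex.isPreconnected (fun x => (l2 (x, 0)).im - Θ x) ?_ ?_
    · refine ContinuousOn.sub (Complex.continuous_im.comp_continuousOn ?_) hΘc
      exact hl2.comp (by fun_prop : Continuous fun x : R2 => (x, (0:ℝ))).continuousOn
        (fun x hx => ⟨hx, h0m⟩)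
    · intro x hx
      have e1 : Complex.exp (l2 (x, 0) - l x) = 1 - z0 / g x := by
        rw [Complex.exp_sub, hle2 (x, 0) ⟨hx, h0m⟩, hle x hx]
        simp only [hY0]
        rw [sub_div, div_self (hgne x hx)]
      have e2 : 0 < (Complex.exp (l2 (x, 0) - l x)).re := by
        rw [e1]
        have e3 : ‖z0 / g x‖ < 1 := by
          rw [norm_div, div_lt_one (by linarith [hcon x hx])]
          linarith [hcon x hx]
        have e4 := (abs_lt.1 ((Complex.abs_re_le_norm _).trans_lt e3)).2
        simp only [Complex.sub_re, Complex.one_re]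
        linarith
      rw [Complex.exp_re] at e2
      have e5 := (pos_iff_pos_of_mul_pos e2).1 (Real.exp_pos _)
      simpa [hΘ] using e5
  have em : n1 = m := by
    refine intlem _ _ _ (hn1 0 h0m) ?_
    have a1 := abs_lt.1 (hm x1 hx1)
    have a2 := abs_le.1 ht1
    rw [abs_lt]; constructor <;> linarith
  have b1 := abs_lt.1 (hm x2 hx2)
  have b2 := abs_lt.1 (hn2 0 h0m)
  rw [en2, ← en1, em] at b2
  have b3 : |Θ x2 - τ| < Real.pi := by rw [abs_lt]; constructor <;> linarith
  linarith

end Part2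

section Part3
def Eqv (F : R2 → R2) : Prop := ∀ x, ∀ w ∈ intLattice, F (x + w) = F x + w

theorem Eqv.iter {F : R2 → R2} (h : Eqv F) (n : ℕ) : Eqv F^[n] := by
  induction n with
  | zero => intro x w _; rfl
  | succ n ih =>
    intro x w hw
    rw [Function.iterate_succ_apply', Function.iterate_succ_apply', ih x w hw, h _ w hw]

theorem Eqv.reduce {F : R2 → R2} (h : Eqv F) (x : R2) : ∃ y ∈ DD, F x - x = F y - y := by
  obtain ⟨w, hw, hD⟩ := exists_lattice x
  refine ⟨x - w, hD, ?_⟩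
  have := h (x - w) w hw
  rw [sub_add_cancel] at this
  rw [this]; abel

theorem Eqv.bdd {F : R2 → R2} (h : Eqv F) (hc : Continuous F) :
    ∃ M, 0 ≤ M ∧ ∀ x, ‖F x - x‖ ≤ M := by
  obtain ⟨M, hM⟩ := DD_compact.exists_bound_of_continuousOn (f := fun x => F x - x)
    (by fun_prop)
  refine ⟨max M 0, le_max_right _ _, fun x => ?_⟩
  obtain ⟨y, hy, e⟩ := h.reduce x
  rw [e]; exact (hM y hy).trans (le_max_left _ _)

theorem rot_of_hull (F : R2 ≃ₜ R2) (hF : Eqv F) (v : R2)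
    (h : ∀ n : ℕ, 1 ≤ n → (n : ℝ) • v ∈ closure (convexHull ℝ (range fun x => F^[n] x - x))) :
    v ∈ rotSet F := by
  have key : ∀ n : ℕ, ∃ x, ‖F^[n+1] x - x - ((n+1 : ℕ) : ℝ) • v‖ ≤ 25 := by
    intro n
    have hE := hF.iter (n+1)
    have hc : Continuous F^[n+1] := F.continuous.iterate _
    have hi : Function.Injective F^[n+1] := F.injective.iterate _
    obtain ⟨c, hcm, hcd⟩ := Metric.mem_closure_iff.1 (h (n+1) (by omega)) 1 one_pos
    have hsub : convexHull ℝ (range fun x => F^[n+1] x - x) ⊆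
        convexHull ℝ (F^[n+1] '' DD) + closedBall 0 2 := by
      refine convexHull_min ?_ ((convex_convexHull ℝ _).add (convex_closedBall _ _))
      rintro _ ⟨x, rfl⟩
      obtain ⟨y, hy, e⟩ := hE.reduce x
      simp only [e]
      refine Set.mem_add.2 ⟨_, subset_convexHull ℝ _ ⟨y, hy, rfl⟩, -y, ?_, by abel⟩
      rw [mem_closedBall_zero_iff, norm_neg]
      linarith [DD_norm hy]
    obtain ⟨y, hy, b, hb, hyb⟩ := Set.mem_add.1 (hsub hcm)
    rw [mem_closedBall_zero_iff] at hb
    obtain ⟨x, hx, hgx⟩ := mz_key (fun x => cI (F^[n+1] x - y)) (by fun_prop)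
      (fun a b hab => hi (sub_left_injective (cI.injective hab)))
      (fun x w hw => by
        rw [hE x w hw, ← map_add]; congr 1; abel)
      (by
        have h1 : (fun x => cI (F^[n+1] x - y)) '' DD =
            (cI.toLinearEquiv.toLinearMap) '' ((fun z => -y + z) '' (F^[n+1] '' DD)) := by
          rw [Set.image_image, Set.image_image]
          refine Set.image_congr fun x _ => ?_
          show cI _ = cI _
          congr 1; abel
        rw [h1, ← LinearMap.image_convexHull]
        refine ⟨0, ?_, by simp⟩
        have h2 : (fun z => -y + z) '' (F^[n+1] '' DD) = (-y) +ᵥ (F^[n+1] '' DD) := rfl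
        rw [h2, convexHull_vadd]
        exact ⟨y, hy, by simp⟩)
    refine ⟨x, ?_⟩
    simp only [cI.norm_map] at hgx
    have e1 : F^[n+1] x - x - ((n+1 : ℕ) : ℝ) • v =
      (F^[n+1] x - y) - x - b - (((n+1 : ℕ) : ℝ) • v - c) := by rw [← hyb]; abel
    rw [e1]
    rw [dist_eq_norm] at hcd
    have := norm_sub_le ((F^[n+1] x - y) - x - b) (((n+1 : ℕ) : ℝ) • v - c)
    have := norm_sub_le ((F^[n+1] x - y) - x) b
    have := norm_sub_le (F^[n+1] x - y) x
    linarith [DD_norm hx]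
  choose z hz using key
  refine ⟨z, fun k => k + 1, tendsto_add_atTop_nat 1, ?_⟩
  rw [tendsto_iff_norm_sub_tendsto_zero]
  refine squeeze_zero (fun _ => norm_nonneg _) (g := fun k : ℕ => (((k + 1 : ℕ) : ℝ))⁻¹ * 25) (fun k => ?_) ?_
  · have hk : (((k + 1 : ℕ) : ℝ)) ≠ 0 := by positivity
    have : ((k + 1 : ℕ) : ℝ)⁻¹ • (F^[k+1] (z k) - z k) - v =
      ((k + 1 : ℕ) : ℝ)⁻¹ • (F^[k+1] (z k) - z k - ((k + 1 : ℕ) : ℝ) • v) := by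
      rw [smul_sub _ _ (((k + 1 : ℕ) : ℝ) • v), smul_smul, inv_mul_cancel₀ hk, one_smul]
    rw [this, norm_smul, Real.norm_of_nonneg (by positivity)]
    gcongr
    exact hz k
  · have := (tendsto_natCast_atTop_atTop (R := ℝ)).comp (tendsto_add_atTop_nat 1)
    have := this.inv_tendsto_atTop.mul_const 25
    simpa using this

theorem rot_functional (F : R2 ≃ₜ R2) (hF : Eqv F) (u : R2) (hu : u ∈ rotSet F)
    (l : R2 →L[ℝ] ℝ) (n : ℕ) (hn : 1 ≤ n) (s : ℝ) (h : ∀ x, l (F^[n] x - x) ≤ s) :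
    (n : ℝ) * l u ≤ s := by
  obtain ⟨z, N, hN, hT⟩ := hu
  have hB : ∃ M, 0 ≤ M ∧ ∀ b < n, ∀ x, |l (F^[b] x - x)| ≤ M := by
    have : ∀ b : ℕ, ∃ M, 0 ≤ M ∧ ∀ x, |l (F^[b] x - x)| ≤ M := by
      intro b
      obtain ⟨M, h0, hM⟩ := (hF.iter b).bdd (F.continuous.iterate _)
      refine ⟨‖l‖ * M, by positivity, fun x => ?_⟩
      exact (l.le_opNorm _).trans (by gcongr; exact hM x)
    choose M h0 hM using this
    refine ⟨∑ b ∈ Finset.range n, M b, Finset.sum_nonneg fun b _ => h0 b, fun b hb x => ?_⟩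
    exact (hM b x).trans (Finset.single_le_sum (f := M) (fun b _ => h0 b) (Finset.mem_range.2 hb))
  obtain ⟨M, hM0, hM⟩ := hB
  have hmul : ∀ a : ℕ, ∀ x, l (F^[n * a] x - x) ≤ a * s := by
    intro a
    induction a with
    | zero => intro x; simp
    | succ a ih =>
      intro x
      rw [mul_add, mul_one, add_comm, Function.iterate_add_apply]
      have e : F^[n] (F^[n * a] x) - x = (F^[n] (F^[n * a] x) - F^[n * a] x) + (F^[n * a] x - x) := by abel
      rw [e, map_add]
      push_cast
      linarith [ih x, h (F^[n * a] x)]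
  have hbd : ∀ m : ℕ, ∀ x, n * l (F^[m] x - x) ≤ m * s + (n * |s| + n * M) := by
    intro m x
    have e0 := Nat.mod_add_div m n
    have hb : m % n < n := Nat.mod_lt _ (by omega)
    have e : F^[m] x - x = (F^[m % n] (F^[n * (m / n)] x) - F^[n * (m / n)] x) + (F^[n * (m / n)] x - x) := by
      rw [← Function.iterate_add_apply, e0]; abel
    rw [e, map_add]
    have h1 := (abs_le.1 (hM _ hb (F^[n * (m / n)] x))).2
    have h2 := hmul (m / n) x
    have e0' : (m : ℝ) = (m % n : ℕ) + n * (m / n : ℕ) := by exact_mod_cast e0.symm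
    have hn0 : (0:ℝ) ≤ n := by positivity
    have h3 : -((m % n : ℕ) * s) ≤ n * |s| := by
      have : ((m % n : ℕ) : ℝ) ≤ n := by exact_mod_cast hb.le
      calc -((m % n : ℕ) * s) ≤ (m % n : ℕ) * |s| := by
            have := neg_abs_le s
            have h0 : (0:ℝ) ≤ (m % n : ℕ) := by positivity
            nlinarith
        _ ≤ _ := by gcongr
    rw [e0']
    have := mul_le_mul_of_nonneg_left (add_le_add h1 h2) hn0
    linarith
  have hT' : Tendsto (fun k => (n:ℝ) * l ((N k : ℝ)⁻¹ • (F^[N k] (z k) - z k))) atTop (𝓝 (n * l u)) :=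
    ((l.continuous.tendsto u).comp hT).const_mul _
  have hinv : Tendsto (fun k => ((N k : ℕ) : ℝ)⁻¹) atTop (𝓝 0) :=
    (tendsto_natCast_atTop_atTop.comp hN).inv_tendsto_atTop
  have hR : Tendsto (fun k => s + ((N k : ℕ) : ℝ)⁻¹ * (n * |s| + n * M)) atTop (𝓝 (s + 0 * (n * |s| + n * M))) :=
    (hinv.mul_const _).const_add _
  rw [zero_mul, add_zero] at hR
  refine le_of_tendsto_of_tendsto hT' hR ?_
  filter_upwards [hN.eventually_ge_atTop 1] with k hk
  have hk' : (0:ℝ) < N k := by exact_mod_cast hk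
  have := mul_le_mul_of_nonneg_left (hbd (N k) (z k)) (inv_nonneg.2 hk'.le)
  rw [map_smul, smul_eq_mul]
  have e : (N k : ℝ)⁻¹ * (N k * s + (n * |s| + n * M)) = s + (N k : ℝ)⁻¹ * (n * |s| + n * M) := by
    field_simp
  rw [e] at this
  linarith

end Part3

section Part4
theorem intLattice_closed : IsClosed (intLattice : Set R2) := by
  have : (intLattice : Set R2) = ⋂ i, (fun x : R2 => x i) ⁻¹' (Set.range ((↑) : ℤ → ℝ)) := by
    ext x
    simp only [Set.mem_iInter, Set.mem_preimage, Set.mem_range]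
    exact ⟨fun h i => (h i).imp fun n hn => hn.symm, fun h i => (h i).imp fun n hn => hn.symm⟩
  rw [this]
  exact isClosed_iInter fun i =>
    Int.isClosedEmbedding_coe_real.isClosed_range.preimage (by fun_prop)

theorem intLattice_countable : (intLattice : Set R2).Countable := by
  have : (intLattice : Set R2) ⊆ Set.range (fun n : Fin 2 → ℤ => (WithLp.toLp 2 (fun i => (n i : ℝ)) : R2)) := by
    intro x hx
    choose n hn using hx
    refine ⟨n, ?_⟩
    ext i; exact (hn i).symm
  exact (Set.countable_range _).mono this

theorem pr_eq_iff (x y : R2) : pr x = pr y ↔ x - y ∈ intLattice := by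
  unfold pr
  rw [QuotientAddGroup.eq, ← neg_mem_iff]
  congr! 1
  abel

theorem pr_add (x y : R2) : pr (x + y) = pr x + pr y := rfl
theorem pr_sub (x y : R2) : pr (x - y) = pr x - pr y := rfl
theorem pr_neg (x : R2) : pr (-x) = - pr x := rfl
theorem pr_add_lat (x w : R2) (hw : w ∈ intLattice) : pr (x + w) = pr x := by
  rw [pr_eq_iff]; simpa using hw
theorem pr_continuous : Continuous pr := continuous_quot_mk
theorem norm_pr_le (x : R2) : ‖pr x‖ ≤ ‖x‖ := QuotientAddGroup.norm_mk_le_norm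
theorem norm_pr_pos {x : R2} (hx : x ∉ intLattice) : 0 < ‖pr x‖ := by
  refine lt_of_le_of_ne (norm_nonneg _) fun h => hx ?_
  have := (QuotientAddGroup.norm_mk_eq_zero_iff_mem_closure (S := intLattice) (m := x)).1 h.symm
  rwa [intLattice_closed.closure_eq] at this

set_option linter.unusedSectionVars false
variable {ι : Type} [Fintype ι] [DecidableEq ι]

def Move (p q : ι → R2) (d : ℝ) : Prop :=
  ∃ h : R2 ≃ₜ R2, Eqv h ∧ (∀ i, h (p i) = q i) ∧ ∀ x, ‖h x - x‖ ≤ d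

theorem Move.trans {p q s : ι → R2} {d e : ℝ} (h1 : Move p q d) (h2 : Move q s e) :
    Move p s (d + e) := by
  obtain ⟨h, hE, hp, hd⟩ := h1
  obtain ⟨k, kE, kp, kd⟩ := h2
  refine ⟨h.trans k, ?_, ?_, ?_⟩
  · intro x w hw
    show k (h (x + w)) = k (h x) + w
    rw [hE x w hw, kE _ w hw]
  · intro i
    show k (h (p i)) = _
    rw [hp, kp]
  · intro x
    show ‖k (h x) - x‖ ≤ _
    have : k (h x) - x = (k (h x) - h x) + (h x - x) := by abel
    rw [this]
    linarith [norm_add_le (k (h x) - h x) (h x - x), hd x, kd (h x)]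

theorem Move.symm {p q : ι → R2} {d : ℝ} (h1 : Move p q d) : Move q p d := by
  obtain ⟨h, hE, hp, hd⟩ := h1
  refine ⟨h.symm, ?_, ?_, ?_⟩
  · intro x w hw
    apply h.injective
    rw [h.apply_symm_apply, hE _ w hw, h.apply_symm_apply]
  · intro i
    rw [← hp i, h.symm_apply_apply]
  · intro x
    have := hd (h.symm x)
    rw [h.apply_symm_apply] at this
    rwa [norm_sub_rev]

theorem Move.mono {p q : ι → R2} {d e : ℝ} (h1 : Move p q d) (h : d ≤ e) : Move p q e := by
  obtain ⟨k, kE, kp, kd⟩ := h1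
  exact ⟨k, kE, kp, fun x => (kd x).trans h⟩

theorem move_small (p q : ι → R2) (r d : ℝ) (hr : 0 < r) (hd0 : 0 ≤ d)
    (hsep : ∀ i j, i ≠ j → r ≤ ‖pr (p i - p j)‖) (hq : ∀ i, ‖q i - p i‖ ≤ d)
    (hsm : (Fintype.card ι : ℝ) * (2 / r * d) < 1) : Move p q d := by
  set φ : ι → R2 → ℝ := fun i x => max 0 (1 - 2 / r * ‖pr (x - p i)‖) with hφ
  have hφ0 : ∀ i x, 0 ≤ φ i x := fun i x => le_max_left _ _
  have hφ1 : ∀ i x, φ i x ≤ 1 := fun i x => max_le zero_le_one (by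
    have : 0 ≤ 2 / r * ‖pr (x - p i)‖ := by positivity
    linarith)
  have hφL : ∀ i x y, |φ i x - φ i y| ≤ 2 / r * ‖x - y‖ := by
    intro i x y
    simp only [hφ]
    rw [max_comm 0 (1 - 2 / r * ‖pr (x - p i)‖), max_comm 0 (1 - 2 / r * ‖pr (y - p i)‖)]
    refine (abs_max_sub_max_le_abs _ _ _).trans ?_
    have e : 1 - 2 / r * ‖pr (x - p i)‖ - (1 - 2 / r * ‖pr (y - p i)‖) =
      2 / r * (‖pr (y - p i)‖ - ‖pr (x - p i)‖) := by ring
    rw [e, abs_mul, abs_of_nonneg (by positivity : (0:ℝ) ≤ 2 / r)]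
    gcongr
    refine (abs_norm_sub_norm_le _ _).trans ?_
    rw [← pr_sub]
    refine (norm_pr_le _).trans (le_of_eq ?_)
    rw [norm_sub_rev]; congr 1; abel
  have hφE : ∀ i x w, w ∈ intLattice → φ i (x + w) = φ i x := by
    intro i x w hw
    simp only [hφ]
    rw [show x + w - p i = (x - p i) + w by abel, pr_add_lat _ _ hw]
  have hφpos : ∀ i x, φ i x ≠ 0 → ‖pr (x - p i)‖ < r / 2 := by
    intro i x h
    by_contra hc
    push Not at hc
    apply h
    apply max_eq_left
    have : 2 / r * (r / 2) ≤ 2 / r * ‖pr (x - p i)‖ := by gcongr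
    rw [show 2 / r * (r / 2) = 1 by field_simp] at this
    linarith
  have hφu : ∀ i j x, φ i x ≠ 0 → φ j x ≠ 0 → i = j := by
    intro i j x hi hj
    by_contra hne
    have h1 := hsep i j hne
    have h2 := hφpos i x hi
    have h3 := hφpos j x hj
    have : pr (p i - p j) = pr (x - p j) - pr (x - p i) := by
      rw [← pr_sub]; congr 1; abel
    rw [this] at h1
    linarith [norm_sub_le (pr (x - p j)) (pr (x - p i))]
  have hφp : ∀ i, φ i (p i) = 1 := by
    intro i
    have : pr 0 = 0 := rfl
    simp [hφ, this]
  set S : R2 → R2 := fun x => ∑ i, φ i x • (q i - p i) with hS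
  have hS1 : ∀ x i, φ i x ≠ 0 → S x = φ i x • (q i - p i) := by
    intro x i hi
    refine Finset.sum_eq_single i (fun j _ hj => ?_) (by simp)
    have : φ j x = 0 := by
      by_contra h; exact hj (hφu j i x h hi)
    rw [this, zero_smul]
  have hSn : ∀ x, ‖S x‖ ≤ d := by
    intro x
    by_cases h : ∃ i, φ i x ≠ 0
    · obtain ⟨i, hi⟩ := h
      rw [hS1 x i hi, norm_smul, Real.norm_of_nonneg (hφ0 i x)]
      have := mul_le_mul (hφ1 i x) (hq i) (norm_nonneg _) zero_le_one
      linarith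
    · push Not at h
      simp only [hS, h]; simpa using hd0
  have hSL : ∀ x y, ‖S x - S y‖ ≤ (Fintype.card ι : ℝ) * (2 / r * d) * ‖x - y‖ := by
    intro x y
    simp only [hS]
    rw [← Finset.sum_sub_distrib]
    refine (norm_sum_le _ _).trans ?_
    refine (Finset.sum_le_card_nsmul _ _ (2 / r * d * ‖x - y‖) fun i _ => ?_).trans ?_
    · rw [← sub_smul, norm_smul]
      calc ‖φ i x - φ i y‖ * ‖q i - p i‖ ≤ (2 / r * ‖x - y‖) * d := by
            gcongr
            · exact hφL i x y
            · exact hq i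
        _ = _ := by ring
    · rw [nsmul_eq_mul, Finset.card_univ]; apply le_of_eq; ring
  set c : NNReal := ⟨(Fintype.card ι : ℝ) * (2 / r * d), by positivity⟩ with hc
  have hA : ApproximatesLinearOn (fun x => x + S x) ((ContinuousLinearEquiv.refl ℝ R2 : R2 ≃L[ℝ] R2) : R2 →L[ℝ] R2) univ c := by
    intro x _ y _
    have : x + S x - (y + S y) - ((ContinuousLinearEquiv.refl ℝ R2 : R2 ≃L[ℝ] R2) : R2 →L[ℝ] R2) (x - y) = S x - S y := by
      simp; abel
    rw [this]
    exact hSL x y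
  have hcN : c < ‖((ContinuousLinearEquiv.refl ℝ R2).symm : R2 →L[ℝ] R2)‖₊⁻¹ := by
    have : ((ContinuousLinearEquiv.refl ℝ R2).symm : R2 →L[ℝ] R2) = ContinuousLinearMap.id ℝ R2 := rfl
    rw [this]
    have h1 : ‖ContinuousLinearMap.id ℝ R2‖₊ = 1 := by
      ext; simp
    rw [h1, inv_one]
    exact hsm
  have hco : ∀ x, hA.toHomeomorph _ (Or.inr hcN) x = x + S x := fun x => rfl
  refine ⟨hA.toHomeomorph _ (Or.inr hcN), ?_, ?_, ?_⟩
  · intro x w hw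
    rw [hco, hco]
    have : S (x + w) = S x := by
      simp only [hS, hφE _ _ w hw]
    rw [this]; abel
  · intro i
    rw [hco, hS1 (p i) i (by rw [hφp]; exact one_ne_zero), hφp, one_smul]; abel
  · intro x
    rw [hco, add_sub_cancel_left]; exact hSn x

theorem sep_exists {T : Type} [TopologicalSpace T] {K : Set T} (hK : IsCompact K)
    (p : ι → T → R2) (hp : ∀ i, Continuous (p i))
    (h : ∀ i j, i ≠ j → ∀ t ∈ K, p i t - p j t ∉ intLattice) :
    ∃ r > 0, ∀ i j, i ≠ j → ∀ t ∈ K, r ≤ ‖pr (p i t - p j t)‖ := by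
  have : ∀ᶠ r in 𝓝[>] (0:ℝ), ∀ i j, i ≠ j → ∀ t ∈ K, r ≤ ‖pr (p i t - p j t)‖ := by
    rw [eventually_all]; intro i
    rw [eventually_all]; intro j
    by_cases hij : i = j
    · simp [hij]
    rcases K.eq_empty_or_nonempty with rfl | hne
    · simp
    obtain ⟨t0, ht0, hm⟩ := hK.exists_isMinOn hne (f := fun t => ‖pr (p i t - p j t)‖)
      ((pr_continuous.comp ((hp i).sub (hp j))).norm.continuousOn)
    have hpos := norm_pr_pos (h i j hij t0 ht0)
    filter_upwards [Ioo_mem_nhdsGT hpos] with r hr _ t ht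
    exact hr.2.le.trans (hm ht)
  obtain ⟨r, hr, hr0⟩ := (this.and self_mem_nhdsWithin).exists
  exact ⟨r, hr0, hr⟩

theorem move_path (p q : ι → R2) (d : ℝ) (hd0 : 0 ≤ d) (hq : ∀ i, ‖q i - p i‖ ≤ d)
    (h : ∀ i j, i ≠ j → ∀ t ∈ Icc (0:ℝ) 1, (p i + t • (q i - p i)) - (p j + t • (q j - p j)) ∉ intLattice) :
    Move p q d := by
  obtain ⟨r, hr, hsep⟩ := sep_exists isCompact_Icc (fun i (t:ℝ) => p i + t • (q i - p i))
    (fun i => by fun_prop) h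
  obtain ⟨N, hN⟩ := exists_nat_gt ((Fintype.card ι : ℝ) * (2 / r * d))
  have hN0 : (0:ℝ) < N := lt_of_le_of_lt (by positivity) hN
  have key : ∀ k : ℕ, k ≤ N → Move p (fun i => p i + ((k:ℝ) / N) • (q i - p i)) (k * (d / N)) := by
    intro k
    induction k with
    | zero => intro _; exact ⟨Homeomorph.refl _, fun _ _ _ => rfl, fun i => by simp, fun x => by simp⟩
    | succ k ih =>
      intro hk
      have hk' : (k:ℝ) / N ∈ Icc (0:ℝ) 1 := ⟨by positivity, by
        rw [div_le_one hN0]; exact_mod_cast (by omega : k ≤ N)⟩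
      have h1 := (ih (by omega)).trans (move_small _ (fun i => p i + (((k+1:ℕ):ℝ) / N) • (q i - p i)) r (d / N) hr (by positivity)
        (fun i j hij => hsep i j hij _ hk') (fun i => by
          have : p i + (((k+1:ℕ):ℝ) / N) • (q i - p i) - (p i + ((k:ℝ) / N) • (q i - p i)) = ((1:ℝ)/N) • (q i - p i) := by
            push_cast; module
          rw [this, norm_smul, Real.norm_of_nonneg (by positivity)]
          calc 1 / (N:ℝ) * ‖q i - p i‖ ≤ 1 / N * d := by gcongr; exact hq i
            _ = d / N := by ring) (by
          rw [show (Fintype.card ι : ℝ) * (2 / r * (d / N)) = ((Fintype.card ι : ℝ) * (2 / r * d)) / N by ring]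
          rwa [div_lt_one hN0]))
      refine h1.mono (le_of_eq ?_)
      push_cast; ring
  have := key N le_rfl
  rw [div_self hN0.ne', mul_div_cancel₀ _ hN0.ne'] at this
  simpa using this

theorem generic (R : ι → ι → R2 → R2 → Prop) (hs : ∀ i j y z, R i j y z → R j i z y)
    (hnull : ∀ i j, i ≠ j → ∀ z, volume {y | ¬ R i j y z} = 0) (q : ι → R2) (η : ℝ) (hη : 0 < η) :
    ∃ q' : ι → R2, (∀ i, ‖q' i - q i‖ < η) ∧ ∀ i j, i ≠ j → R i j (q' i) (q' j) := by
  have : ∀ s : Finset ι, ∃ q' : ι → R2, (∀ i, ‖q' i - q i‖ < η) ∧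
      ∀ i ∈ s, ∀ j ∈ s, i ≠ j → R i j (q' i) (q' j) := by
    intro s
    induction s using Finset.induction_on with
    | empty => exact ⟨q, by simpa using fun _ => hη, by simp⟩
    | insert a s ha ih =>
      obtain ⟨q', h1, h2⟩ := ih
      have hz : volume (⋃ j ∈ s, {y | ¬ R a j y (q' j)}) = 0 := by
        refine (measure_biUnion_null_iff s.countable_toSet).2 fun j hj => ?_
        exact hnull a j (by rintro rfl; exact ha hj) _
      obtain ⟨y, hy, hyn⟩ : ∃ y ∈ ball (q a) η, y ∉ ⋃ j ∈ s, {y | ¬ R a j y (q' j)} := by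
        by_contra hcon
        push Not at hcon
        have := measure_mono_null hcon hz
        exact (measure_ball_pos volume (q a) hη).ne' this
      refine ⟨Function.update q' a y, ?_, ?_⟩
      · intro i
        by_cases hi : i = a
        · subst hi; rw [Function.update_self, ← dist_eq_norm]; exact hy
        · rw [Function.update_of_ne hi]; exact h1 i
      · simp only [Set.mem_iUnion, Set.mem_ofPred_eq, not_exists, not_not] at hyn
        intro i hi j hj hij
        rw [Finset.mem_insert] at hi hj
        rcases hi with rfl | hi <;> rcases hj with rfl | hj
        · exact absurd rfl hij
        · rw [Function.update_self, Function.update_of_ne hij.symm]; exact hyn j hj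
        · rw [Function.update_self, Function.update_of_ne hij]; exact hs _ _ _ _ (hyn i hi)
        · rw [Function.update_of_ne (by rintro rfl; exact ha hi),
            Function.update_of_ne (by rintro rfl; exact ha hj)]
          exact h2 i hi j hj hij
  obtain ⟨q', h1, h2⟩ := this Finset.univ
  exact ⟨q', h1, fun i j => h2 i (Finset.mem_univ _) j (Finset.mem_univ _)⟩

theorem null_line (a b : R2) : volume {y : R2 | ∃ s : ℝ, y = a + s • b} = 0 := by
  set A : AffineSubspace ℝ R2 := AffineSubspace.mk' a (Submodule.span ℝ {b}) with hA
  have hne : A ≠ ⊤ := by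
    intro h
    have h1 : A.direction = ⊤ := by rw [h, AffineSubspace.direction_top]
    rw [hA, AffineSubspace.direction_mk'] at h1
    have h2 : Module.finrank ℝ (Submodule.span ℝ {b}) = 2 := by
      rw [h1, finrank_top]; simp
    have h3 := finrank_span_le_card (R := ℝ) ({b} : Set R2)
    simp only [Set.toFinset_singleton, Finset.card_singleton] at h3
    omega
  refine measure_mono_null ?_ (Measure.addHaar_affineSubspace volume A hne)
  rintro y ⟨s, rfl⟩
  simp only [hA, SetLike.mem_coe, AffineSubspace.mem_mk', vsub_eq_sub, add_sub_cancel_left]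
  exact Submodule.smul_mem _ _ (Submodule.mem_span_singleton_self b)

theorem move_exists (p q : ι → R2) (d : ℝ) (hd : 0 < d) (hq : ∀ i, ‖q i - p i‖ < d)
    (hp : ∀ i j, i ≠ j → p i - p j ∉ intLattice) (hqq : ∀ i j, i ≠ j → q i - q j ∉ intLattice) :
    Move p q d := by
  obtain ⟨d', hd', hd'0, hd'd⟩ : ∃ d', (∀ i, ‖q i - p i‖ ≤ d') ∧ 0 < d' ∧ d' < d := by
    have : ∀ᶠ e in 𝓝[<] d, ∀ i, ‖q i - p i‖ ≤ e := by
      rw [eventually_all]; intro i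
      filter_upwards [Ioo_mem_nhdsLT (hq i)] with e he using he.1.le
    obtain ⟨e, h1, h2⟩ := (this.and (Ioo_mem_nhdsLT hd)).exists
    exact ⟨e, h1, h2.1, h2.2⟩
  obtain ⟨r, hr, hsep⟩ := sep_exists (isCompact_singleton (x := ())) (fun i (_:Unit) => q i)
    (fun i => continuous_const) (fun i j hij t _ => hqq i j hij)
  obtain ⟨η, hη0, hη1, hη2⟩ : ∃ η, 0 < η ∧ η ≤ (d - d') / 2 ∧ (Fintype.card ι : ℝ) * (2 / r * η) < 1 := by
    have h1 : Tendsto (fun η : ℝ => (Fintype.card ι : ℝ) * (2 / r * η)) (𝓝[>] 0) (𝓝 ((Fintype.card ι : ℝ) * (2 / r * 0))) :=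
      ((by fun_prop : Continuous (fun η : ℝ => (Fintype.card ι : ℝ) * (2 / r * η))).tendsto 0).mono_left nhdsWithin_le_nhds
    have h2 := h1.eventually_lt_const (u := 1) (by simp)
    obtain ⟨η, h3, h4⟩ := (h2.and (Ioo_mem_nhdsGT (show (0:ℝ) < (d - d') / 2 by linarith))).exists
    exact ⟨η, h4.1, h4.2.le, h3⟩
  obtain ⟨q', hq', hR⟩ := generic
    (fun i j y z => ∀ t ∈ Icc (0:ℝ) 1, (p i + t • (y - p i)) - (p j + t • (z - p j)) ∉ intLattice)
    (fun i j y z h t ht hm => h t ht (by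
      rw [← neg_mem_iff, neg_sub]; exact hm))
    (fun i j hij z => by
      have hz : volume (⋃ u ∈ (intLattice : Set R2), {y : R2 | ∃ s : ℝ, y = (z + (p i - p j)) + s • (u - (p i - p j))}) = 0 :=
        (measure_biUnion_null_iff intLattice_countable).2 fun u _ => null_line _ _
      refine measure_mono_null ?_ hz
      intro y hy
      simp only [Set.mem_ofPred_eq, not_forall, not_not] at hy
      obtain ⟨t, ht, hm⟩ := hy
      refine Set.mem_biUnion hm ⟨t⁻¹, ?_⟩
      have ht0 : t ≠ 0 := by
        rintro rfl
        apply hp i j hij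
        simpa using hm
      have e : p i + t • (y - p i) - (p j + t • (z - p j)) - (p i - p j) = t • (y - z - (p i - p j)) := by module
      rw [e, smul_smul, inv_mul_cancel₀ ht0, one_smul]
      abel)
    q η hη0
  have m1 : Move p q' (d' + η) := by
    refine move_path p q' _ (by linarith) (fun i => ?_) (fun i j hij t ht => hR i j hij t ht)
    have : q' i - p i = (q i - p i) + (q' i - q i) := by abel
    rw [this]
    linarith [norm_add_le (q i - p i) (q' i - q i), hd' i, hq' i]
  have m2 : Move q q' η := move_small q q' r η hr hη0.le (fun i j hij => hsep i j hij () rfl)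
    (fun i => (hq' i).le) hη2
  exact (m1.trans m2.symm).mono (by linarith)

end Part4

section Part5
theorem descend_fun (G : R2 ≃ₜ R2) (hG : Eqv G) :
    ∃ g : T2 → T2, Continuous g ∧ ∀ x, g (pr x) = pr (G x) := by
  have hs : Function.Surjective pr := Quot.mk_surjective
  have hwd : ∀ x y, pr x = pr y → pr (G x) = pr (G y) := by
    intro x y h
    rw [pr_eq_iff] at h
    have := hG y _ h
    rw [add_sub_cancel] at this
    rw [this, pr_add_lat _ _ h]
  have e : ∀ x, pr (G (Function.surjInv hs (pr x))) = pr (G x) := fun x =>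
    hwd _ _ (Function.surjInv_eq hs _)
  refine ⟨fun t => pr (G (Function.surjInv hs t)), ?_, e⟩
  have hq : IsQuotientMap pr := isQuotientMap_quot_mk
  rw [hq.continuous_iff]
  have : (fun t => pr (G (Function.surjInv hs t))) ∘ pr = pr ∘ G := funext e
  rw [this]
  exact pr_continuous.comp G.continuous

theorem Eqv.symm {G : R2 ≃ₜ R2} (hG : Eqv G) : Eqv G.symm := by
  intro x w hw
  apply G.injective
  rw [G.apply_symm_apply, hG _ w hw, G.apply_symm_apply]

theorem descend (G : R2 ≃ₜ R2) (hG : Eqv G) : ∃ g : T2 ≃ₜ T2, IsLift g G := by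
  obtain ⟨g, gc, hg⟩ := descend_fun G hG
  obtain ⟨k, kc, hk⟩ := descend_fun G.symm hG.symm
  have hs : Function.Surjective pr := Quot.mk_surjective
  refine ⟨⟨⟨g, k, ?_, ?_⟩, gc, kc⟩, fun x => (hg x).symm, hG⟩
  · intro t; obtain ⟨x, rfl⟩ := hs t; rw [hg, hk, G.symm_apply_apply]
  · intro t; obtain ⟨x, rfl⟩ := hs t; rw [hk, hg, G.apply_symm_apply]

theorem rot_periodic (G : R2 ≃ₜ R2) (hG : Eqv G) (x w : R2) (hw : w ∈ intLattice) (q : ℕ) (hq : 1 ≤ q)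
    (h : G^[q] x = x + w) : (q : ℝ)⁻¹ • w ∈ rotSet G := by
  have key : ∀ k : ℕ, G^[q * k] x = x + (k : ℝ) • w := by
    intro k
    have hk : ∀ k : ℕ, (k : ℝ) • w ∈ intLattice := fun k => by
      rw [Nat.cast_smul_eq_nsmul]; exact nsmul_mem hw k
    induction k with
    | zero => simp
    | succ k ih =>
      rw [mul_add, mul_one, add_comm, Function.iterate_add_apply, ih, hG.iter q _ _ (hk k), h]
      push_cast; module
  refine ⟨fun _ => x, fun k => q * (k + 1), ?_, ?_⟩
  · refine tendsto_atTop_mono (fun k => ?_) (tendsto_add_atTop_nat 1)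
    show k + 1 ≤ q * (k + 1)
    nlinarith
  · refine tendsto_const_nhds.congr fun k => ?_
    rw [key, add_sub_cancel_left, smul_smul]
    congr 1
    have : (q:ℝ) ≠ 0 := by positivity
    have : (k:ℝ) + 1 ≠ 0 := by positivity
    push_cast
    field_simp

theorem closing (F : R2 ≃ₜ R2) (hF : Eqv F) (δ δ' : ℝ) (h0 : 0 < δ') (hδ : δ' < δ)
    (hS : UpperStable Homeo0 F δ) (m : ℕ) (x : ℕ → R2) (w : R2) (hw : w ∈ intLattice)
    (hx : x (m + 1) = x 0 + w) (h : ∀ i ≤ m, ‖x (i + 1) - F (x i)‖ < δ') :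
    ((m + 1 : ℕ) : ℝ)⁻¹ • w ∈ rotSet F := by
  set c : Fin (m + 1) → R2 := fun i => if i = Fin.last m then w else 0 with hc
  have hcl : ∀ i, c i ∈ intLattice := by
    intro i; simp only [hc]; split_ifs; exacts [hw, zero_mem _]
  have hopen : ∀ᶠ y in 𝓝 (fun i : Fin (m + 1) => x i), ∀ i, ‖y (i + 1) + c i - F (y i)‖ < δ' := by
    rw [eventually_all]; intro i
    have hcont : Continuous (fun y : Fin (m + 1) → R2 => ‖y (i + 1) + c i - F (y i)‖) := by fun_prop
    refine hcont.continuousAt.eventually_lt_const ?_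
    have : x ((i + 1 : Fin (m + 1)) : ℕ) + c i = x (i + 1) := by
      by_cases hi : i = Fin.last m
      · subst hi
        simp [hc, hx]
      · have : ((i + 1 : Fin (m + 1)) : ℕ) = i + 1 := Fin.val_add_one_of_lt (Fin.lt_last_iff_ne_last.2 hi)
        rw [this]; simp [hc, hi]
    beta_reduce
    rw [this]
    exact h i (by omega)
  obtain ⟨η, hη, hball⟩ := Metric.eventually_nhds_iff.1 hopen
  obtain ⟨y, hy1, hy2⟩ := generic (fun (_ _ : Fin (m + 1)) y z => y - z ∉ intLattice)
    (fun i j y z h hm => h (by rw [← neg_mem_iff, neg_sub]; exact hm))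
    (fun i j _ z => by
      refine Set.Countable.measure_zero ?_ _
      refine (intLattice_countable.image (fun u => u + z)).mono ?_
      intro y hy
      simp only [Set.mem_ofPred_eq, not_not] at hy
      exact ⟨y - z, hy, by simp⟩)
    (fun i => x i) η hη
  have hy := hball (y := y) (by
    rw [dist_pi_lt_iff hη]; intro i; rw [dist_eq_norm]; exact hy1 i)
  obtain ⟨k, kE, kp, kd⟩ := move_exists (fun i => F (y i)) (fun i => y (i + 1) + c i) δ' h0 hy
    (fun i j hij hm => by
      rw [← pr_eq_iff] at hm
      have h1 := (pr_eq_iff _ _).1 hm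
      have h2 := hF (y j + 0) _ h1
      rw [add_zero, add_sub_cancel] at h2
      have h3 := hF.symm (F (y j)) _ h1
      rw [add_sub_cancel, F.symm_apply_apply, F.symm_apply_apply] at h3
      apply hy2 i j hij
      rw [h3]; simpa using h1)
    (fun i j hij hm => by
      have hne : i + 1 ≠ j + 1 := fun e => hij (add_right_cancel e)
      apply hy2 _ _ hne
      rw [← pr_eq_iff] at hm ⊢
      rwa [pr_add_lat _ _ (hcl i), pr_add_lat _ _ (hcl j)] at hm)
  set G : R2 ≃ₜ R2 := F.trans k with hGdef
  have hGa : ∀ z, G z = k (F z) := fun z => rfl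
  have hG : Eqv G := by
    intro z u hu
    rw [hGa, hGa, hF z u hu, kE _ u hu]
  have hiter : ∀ j : ℕ, ∀ hj : j < m + 1, G^[j] (y 0) = y ⟨j, hj⟩ := by
    intro j
    induction j with
    | zero => intro _; rfl
    | succ j ih =>
      intro hj
      rw [Function.iterate_succ_apply', ih (by omega), hGa, kp]
      have hl : (⟨j, by omega⟩ : Fin (m + 1)) ≠ Fin.last m := by
        intro e; have := congrArg Fin.val e; simp at this; omega
      have h1 : (⟨j, by omega⟩ : Fin (m + 1)) + 1 = ⟨j + 1, hj⟩ := by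
        ext
        rw [Fin.val_add_one_of_lt (Fin.lt_last_iff_ne_last.2 hl)]
      beta_reduce
      rw [h1]; simp [hc, hl]
  have hper : G^[m + 1] (y 0) = y 0 + w := by
    rw [Function.iterate_succ_apply', hiter m (by omega), hGa, kp]
    have : (⟨m, by omega⟩ : Fin (m + 1)) = Fin.last m := rfl
    rw [this]; simp [hc]
  have hrot := rot_periodic G hG _ w hw (m + 1) (by omega) hper
  obtain ⟨g, hg⟩ := descend G hG
  refine hS g ⟨G, hg⟩ G hg ?_ hrot
  refine lt_of_le_of_lt (ciSup_le fun z => ?_) hδ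
  rw [dist_comm, dist_eq_norm]
  exact kd (F z)

end Part5

section Part6
theorem cells (η : ℝ) (hη : 0 < η) : ∃ (T : Finset R2) (κ : R2 → R2), (∀ x, κ x ∈ T) ∧
    ∀ x y, κ x = κ y → ∃ w ∈ intLattice, ‖x + w - y‖ < η := by
  obtain ⟨t, -, ht, hcov⟩ := DD_compact.finite_cover_balls (half_pos hη)
  have : ∀ x : R2, ∃ c ∈ t, ∃ w ∈ intLattice, ‖x - w - c‖ < η / 2 := by
    intro x
    obtain ⟨w, hw, hD⟩ := exists_lattice x
    obtain ⟨c, hc, hb⟩ := Set.mem_iUnion₂.1 (hcov hD)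
    exact ⟨c, hc, w, hw, by rw [← dist_eq_norm]; exact hb⟩
  choose κ hκ w hw hn using this
  refine ⟨ht.toFinset, κ, fun x => by simpa using hκ x, fun x y h => ⟨w y - w x, sub_mem (hw y) (hw x), ?_⟩⟩
  have e : x + (w y - w x) - y = (x - w x - κ x) - (y - w y - κ y) := by rw [h]; abel
  rw [e]
  linarith [norm_sub_le (x - w x - κ x) (y - w y - κ y), hn x, hn y]

theorem closed_bound (F : R2 ≃ₜ R2) (hF : Eqv F) (δ : ℝ) (hδ : 0 < δ)
    (hS : UpperStable Homeo0 F δ) (l : R2 →L[ℝ] ℝ) (n : ℕ) (hn : 1 ≤ n) (σ : ℝ)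
    (h : ∀ x, l (F^[n] x - x) ≤ n * σ) (m : ℕ) (x : ℕ → R2)
    (hx : ∀ i ≤ m, ‖x (i + 1) - F (x i)‖ < δ / 2) (w : R2) (hw : w ∈ intLattice)
    (hxw : ‖x 0 + w - x (m + 1)‖ < δ / 4) :
    l (x (m + 1) - x 0) ≤ ((m + 1 : ℕ) : ℝ) * σ + ‖l‖ * (δ / 4) := by
  have hr := closing F hF δ (3 * δ / 4) (by linarith) (by linarith) hS m
    (fun i => if i = m + 1 then x 0 + w else x i) w hw (by simp) (by
      intro i hi
      have h1 : i ≠ m + 1 := by omega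
      simp only [h1, if_false]
      split_ifs with h2
      · have e : x 0 + w - F (x i) = (x 0 + w - x (m + 1)) + (x (i + 1) - F (x i)) := by
          rw [h2]; abel
        rw [e]
        linarith [norm_add_le (x 0 + w - x (m + 1)) (x (i + 1) - F (x i)), hx i hi]
      · linarith [hx i hi])
  have h1 := rot_functional F hF _ hr l n hn _ h
  have hn0 : (0:ℝ) < n := by exact_mod_cast hn
  have h2 := le_of_mul_le_mul_left h1 hn0
  rw [map_smul, smul_eq_mul, inv_mul_le_iff₀ (by positivity)] at h2
  have e : x (m + 1) - x 0 = w - (x 0 + w - x (m + 1)) := by abel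
  rw [e, map_sub]
  have h3 := (l.le_opNorm (x 0 + w - x (m + 1)))
  have h4 := (abs_le.1 h3).1
  have h5 : ‖l‖ * ‖x 0 + w - x (m + 1)‖ ≤ ‖l‖ * (δ / 4) := by gcongr
  linarith

theorem pseudo_bound (F : R2 ≃ₜ R2) (hF : Eqv F) (δ : ℝ) (hδ : 0 < δ)
    (hS : UpperStable Homeo0 F δ) (l : R2 →L[ℝ] ℝ) (n : ℕ) (hn : 1 ≤ n) (σ : ℝ)
    (h : ∀ x, l (F^[n] x - x) ≤ n * σ) :
    ∃ B : ℝ, ∀ (N : ℕ) (x : ℕ → R2), (∀ i < N, ‖x (i + 1) - F (x i)‖ < δ / 2) →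
      l (x N - x 0) ≤ N * σ + B := by
  classical
  obtain ⟨T, κ, hκT, hκ⟩ := cells (δ / 4) (by linarith)
  obtain ⟨M, hM0, hM⟩ := hF.bdd F.continuous
  set D : ℝ := |σ| + ‖l‖ * (δ / 4 + δ / 2 + M) with hD
  have hl0 := norm_nonneg l
  have hDl : ‖l‖ * (δ / 4) ≤ D := by
    have : 0 ≤ ‖l‖ * (δ / 2 + M) := by positivity
    have := abs_nonneg σ
    rw [hD]; linarith
  have key : ∀ (k : ℕ) (S : Finset R2), S.card = k → ∀ (N : ℕ) (x : ℕ → R2),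
      (∀ i < N, ‖x (i + 1) - F (x i)‖ < δ / 2) → (∀ i ≤ N, κ (x i) ∈ S) →
      l (x N - x 0) ≤ N * σ + k * D := by
    intro k
    induction k with
    | zero =>
      intro S hSc N x _ hc
      rw [Finset.card_eq_zero] at hSc
      have := hc 0 (Nat.zero_le _)
      simp [hSc] at this
    | succ k ih =>
      intro S hSc N x hx hc
      set j := Nat.findGreatest (fun i => κ (x i) = κ (x 0)) N with hj
      have hjN : j ≤ N := Nat.findGreatest_le N
      have hjP : κ (x j) = κ (x 0) := Nat.findGreatest_spec (P := fun i => κ (x i) = κ (x 0)) (Nat.zero_le N) rfl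
      have hjg : ∀ i, j < i → i ≤ N → κ (x i) ≠ κ (x 0) := fun i h1 h2 =>
        Nat.findGreatest_is_greatest h1 h2
      have hpiece : l (x j - x 0) ≤ j * σ + ‖l‖ * (δ / 4) := by
        rcases Nat.eq_zero_or_pos j with h0 | h0
        · rw [h0]; simp; positivity
        · obtain ⟨m, hm⟩ : ∃ m, j = m + 1 := ⟨j - 1, by omega⟩
          obtain ⟨w, hw, hwn⟩ := hκ (x 0) (x j) hjP.symm
          rw [hm] at hwn ⊢
          exact closed_bound F hF δ hδ hS l n hn σ h m x (fun i hi => hx i (by omega)) w hw hwn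
      have hkD : 0 ≤ (k:ℝ) * D := by
        have : 0 ≤ D := le_trans (by positivity) hDl
        positivity
      rcases hjN.eq_or_lt with he | hlt
      · rw [← he]
        push_cast
        linarith
      · obtain ⟨N', hN'⟩ : ∃ N', N = j + 1 + N' := ⟨N - j - 1, by omega⟩
        have htail := ih (S.erase (κ (x 0))) (by
            rw [Finset.card_erase_of_mem (hc 0 (Nat.zero_le _)), hSc]; rfl) N' (fun i => x (j + 1 + i))
          (fun i hi => hx (j + 1 + i) (by omega))
          (fun i hi => Finset.mem_erase.2 ⟨hjg _ (by omega) (by omega), hc _ (by omega)⟩)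
        simp only [add_zero] at htail
        rw [← hN'] at htail
        have hstep : l (x (j + 1) - x j) ≤ ‖l‖ * (δ / 2 + M) := by
          refine (le_abs_self _).trans ((l.le_opNorm _).trans ?_)
          gcongr
          have e : x (j + 1) - x j = (x (j + 1) - F (x j)) + (F (x j) - x j) := by abel
          rw [e]
          linarith [norm_add_le (x (j + 1) - F (x j)) (F (x j) - x j), hx j hlt, hM (x j)]
        have e : x N - x 0 = (x N - x (j + 1)) + (x (j + 1) - x j) + (x j - x 0) := by abel
        rw [e, map_add, map_add]
        have hNr : (N : ℝ) = j + 1 + N' := by exact_mod_cast hN'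
        have := neg_abs_le σ
        rw [hNr]; push_cast
        have e2 : ((k:ℝ) + 1) * D = k * D + D := by ring
        rw [e2]
        have e3 : D = |σ| + (‖l‖ * (δ / 4) + ‖l‖ * (δ / 2 + M)) := by rw [hD]; ring
        have e4 : ((j:ℝ) + 1 + N') * σ = j * σ + σ + N' * σ := by ring
        linarith
  exact ⟨T.card * D, fun N x hx => key _ T rfl N x hx fun i _ => hκT _⟩

theorem pseudo_sub (F : R2 ≃ₜ R2) (hF : Eqv F) (δ : ℝ) (hδ : 0 < δ)
    (hS : UpperStable Homeo0 F δ) : pseudoRotSet F (δ / 2) ⊆ rotSet F := by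
  rintro v ⟨N, x, hN, hx, hT⟩
  refine rot_of_hull F hF v fun n hn => ?_
  by_contra hv
  obtain ⟨l, s, hl, hs⟩ := geometric_hahn_banach_closed_point
    (convex_convexHull ℝ _).closure isClosed_closure hv
  have hn0 : (0:ℝ) < n := by exact_mod_cast hn
  obtain ⟨B, hB⟩ := pseudo_bound F hF δ hδ hS l n hn (s / n) (fun y => by
    rw [mul_div_cancel₀ _ hn0.ne']
    exact (hl _ (subset_closure (subset_convexHull ℝ _ ⟨y, rfl⟩))).le)
  have hlim : l v ≤ s / n := by
    have hT' : Tendsto (fun k => l ((N k : ℝ)⁻¹ • (x k (N k) - x k 0))) atTop (𝓝 (l v)) :=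
      (l.continuous.tendsto v).comp hT
    have hinv : Tendsto (fun k => ((N k : ℕ) : ℝ)⁻¹) atTop (𝓝 0) :=
      (tendsto_natCast_atTop_atTop.comp hN).inv_tendsto_atTop
    have hR : Tendsto (fun k => s / n + ((N k : ℕ) : ℝ)⁻¹ * B) atTop (𝓝 (s / n + 0 * B)) :=
      (hinv.mul_const _).const_add _
    rw [zero_mul, add_zero] at hR
    refine le_of_tendsto_of_tendsto hT' hR ?_
    filter_upwards [hN.eventually_ge_atTop 1] with k hk
    have hk' : (0:ℝ) < N k := by exact_mod_cast hk
    have h1 := hB (N k) (x k) (fun i hi => by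
      rw [← dist_eq_norm, dist_comm]; exact hx k i hi)
    have := mul_le_mul_of_nonneg_left h1 (inv_nonneg.2 hk'.le)
    rw [map_smul, smul_eq_mul]
    rw [mul_add, inv_mul_cancel_left₀ hk'.ne'] at this
    exact this
  rw [map_smul, smul_eq_mul] at hs
  rw [le_div_iff₀ hn0] at hlim
  linarith

theorem sub_pseudo (F : R2 ≃ₜ R2) (ε : ℝ) (hε : 0 < ε) : rotSet F ⊆ pseudoRotSet F ε := by
  rintro v ⟨z, n, hn, hT⟩
  refine ⟨n, fun k i => F^[i] (z k), hn, ?_, hT⟩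
  intro k i _
  beta_reduce
  rw [Function.iterate_succ_apply', dist_self]; exact hε

theorem rot_shift (G G' : R2 ≃ₜ R2) (hG : Eqv G) (c : R2) (hc : c ∈ intLattice)
    (h : ∀ x, G' x = G x + c) (v : R2) (hv : v ∈ rotSet G) : v + c ∈ rotSet G' := by
  obtain ⟨z, n, hn, hT⟩ := hv
  refine ⟨z, n, hn, ?_⟩
  have hit : ∀ (k : ℕ) x, G'^[k] x = G^[k] x + (k:ℝ) • c := by
    intro k x
    induction k with
    | zero => simp
    | succ k ih =>
      have hk : (k : ℝ) • c ∈ intLattice := by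
        rw [Nat.cast_smul_eq_nsmul]; exact nsmul_mem hc k
      rw [Function.iterate_succ_apply', Function.iterate_succ_apply', ih, h, hG _ _ hk]
      push_cast; module
  refine (hT.add_const c).congr' ?_
  filter_upwards [hn.eventually_ge_atTop 1] with k hk
  have hk' : (n k : ℝ) ≠ 0 := by positivity
  rw [hit, show G^[n k] (z k) + (n k : ℝ) • c - z k = (G^[n k] (z k) - z k) + (n k : ℝ) • c by abel,
    smul_add _ _ ((n k : ℝ) • c), smul_smul, inv_mul_cancel₀ hk', one_smul]

theorem lifts_differ (f : T2 ≃ₜ T2) (F F' : R2 ≃ₜ R2) (h : IsLift f F) (h' : IsLift f F') :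
    ∃ c ∈ intLattice, ∀ x, F' x = F x + c := by
  have hm : ∀ x, F' x - F x ∈ intLattice := fun x => by
    rw [← pr_eq_iff, h.proj, h'.proj]
  refine ⟨F' 0 - F 0, hm 0, fun x => ?_⟩
  have : F' x - F x = F' 0 - F 0 := by
    ext i
    choose N hN using fun x => hm x i
    have hcN : Continuous N := by
      rw [Int.isClosedEmbedding_coe_real.isEmbedding.continuous_iff]
      have : ((↑) : ℤ → ℝ) ∘ N = fun x => (F' x - F x) i := funext fun x => (hN x).symm
      rw [this]
      fun_prop
    rw [hN, hN, PreconnectedSpace.constant inferInstance hcN (x := x) (y := 0)]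
  rw [← this]; abel

theorem upper_transfer (f : T2 ≃ₜ T2) (F F' : R2 ≃ₜ R2) (h : IsLift f F) (h' : IsLift f F') (δ : ℝ)
    (hS : UpperStable Homeo0 F δ) : UpperStable Homeo0 F' δ := by
  obtain ⟨c, hc, hcF⟩ := lifts_differ f F F' h h'
  intro g hg G hG hd v hv
  set G' : R2 ≃ₜ R2 := G.trans (Homeomorph.addRight (-c)) with hG'
  have hGa : ∀ x, G' x = G x + -c := fun x => rfl
  have hGl : IsLift g G' := by
    refine ⟨fun x => ?_, fun x w hw => ?_⟩
    · rw [hGa, pr_add_lat _ _ (neg_mem hc), hG.proj]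
    · rw [hGa, hGa, hG.equivariant x w hw]; abel
  have h1 := hS g hg G' hGl (by
    have : supDist F G' = supDist F' G := by
      unfold supDist
      congr 1; ext x
      rw [dist_eq_norm, dist_eq_norm, hcF, hGa]; congr 1; abel
    rw [this]; exact hd)
  have h2 := rot_shift F F' h.equivariant c hc hcF _
    (h1 (rot_shift G G' hG.equivariant (-c) (neg_mem hc) hGa v hv))
  simpa using h2

theorem main_thm (f : T2 ≃ₜ T2) (δ : ℝ) (hδ : 0 < δ)
    (hstab : ∃ F₀ : R2 ≃ₜ R2, IsLift f F₀ ∧ UpperStable Homeo0 F₀ δ) :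
    ∀ F : R2 ≃ₜ R2, IsLift f F → rotSet F = pseudoRotSet (⇑F) (δ / 2) := by
  intro F hF
  obtain ⟨F₀, h0, hS⟩ := hstab
  exact (sub_pseudo F _ (half_pos hδ)).antisymm
    (pseudo_sub F hF.equivariant δ hδ (upper_transfer f F₀ F h0 hF δ hS))

end Part6

/-- If the rotation set of `f ∈ Homeo₀(T²)` is `δ`-upper-stable in
`Homeo₀(T²)` for some `δ > 0`, then for any lift `F` of `f` the rotation set equals
the `(δ/2)`-pseudo-rotation set: `ρ(F) = ρ_{δ/2}(F)`. -/
theorem rotSet_eq_pseudoRotSet_of_upper_stable (f : T2 ≃ₜ T2) (hf : f ∈ Homeo0)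
    (δ : ℝ) (hδ : 0 < δ)
    (hstab : ∃ F₀ : R2 ≃ₜ R2, IsLift f F₀ ∧ UpperStable Homeo0 F₀ δ) :
    ∀ F : R2 ≃ₜ R2, IsLift f F → rotSet F = pseudoRotSet (⇑F) (δ / 2) := by
  exact main_thm f δ hδ hstab
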